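/- For z = E + iη with |E| < 3 and 0 < η ≤ 3: if |E| ≤ 2 then Im m_sc(z) is comparable to √(κ+η), and if |E| ≥ 2 then Im m_sc(z) is comparable to η/√(κ+η), where κ = ||E|-2|. -/

import Mathlib

/-- The distortion estimate `Im √(z² - 4) ≲ Im m` for a root of `m² + zm + 1 = 0`
in the upper half-plane, where `z = E + iη` and `m = a + ib`. -/
lemma im_two_mul_add_le {E η a b : ℝ} (hE : |E| ≤ 3) (hη : 0 < η) (hη3 : η ≤ 3) (hb : 0 < b)
    (hre : a ^ 2 - b ^ 2 + E * a - η * b + 1 = 0) (him : 2 * a * b + E * b + η * a = 0) :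
    2 * b + η ≤ 50 * b := by
  obtain ⟨t, ht⟩ : ∃ t, t = a ^ 2 + b ^ 2 := ⟨_, rfl⟩
  have htpos : 0 < t := by rw [ht]; positivity
  have h1 : η * t = b * (1 - t) := by rw [ht]; linear_combination a * him - b * hre
  have h2 : E * t = -(a * (1 + t)) := by rw [ht]; linear_combination a * hre + b * him
  have hE2 : E ^ 2 ≤ 9 := by
    have := pow_le_pow_left₀ (abs_nonneg E) hE 2
    rw [sq_abs] at this; linarith
  have h3 : (E ^ 2 + η ^ 2) * t ^ 2 = t * (1 - t) ^ 2 + 4 * a ^ 2 * t := by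
    have : (E ^ 2 + η ^ 2) * t ^ 2 = (a * (1 + t)) ^ 2 + (b * (1 - t)) ^ 2 := by
      rw [← h1, ← neg_sq (a * (1 + t)), ← h2]; ring
    rw [this]; linear_combination (-(1 - t) ^ 2) * ht
  have h4 : (1 - t) ^ 2 ≤ 18 * t := by
    have h5 : (E ^ 2 + η ^ 2) * t ^ 2 ≤ 18 * t ^ 2 := by gcongr; nlinarith
    have h6 : 0 ≤ 4 * a ^ 2 * t := by positivity
    refine le_of_mul_le_mul_left ?_ htpos
    nlinarith
  have h7 : 1 / 49 ≤ t := by nlinarith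
  have h8 : (b + η) * (1 / 49) ≤ (b + η) * t := by gcongr
  linarith

/-- The modulus of `w² = z² - 4` is comparable to the distance of `E` to the spectral edge
plus `η`; here `w = X + iY` and `z = E + iη`. -/
lemma normSq_bounds_of_sq_eq {E η X Y : ℝ} (hE : |E| ≤ 3) (hη : 0 < η) (hη3 : η ≤ 3)
    (hre : X ^ 2 - Y ^ 2 = E ^ 2 - η ^ 2 - 4) (him : X * Y = E * η) :
    |(|E| - 2)| + η ≤ X ^ 2 + Y ^ 2 ∧ X ^ 2 + Y ^ 2 ≤ 6 * (|(|E| - 2)| + η) := by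
  have hD : (X ^ 2 + Y ^ 2) ^ 2
      = (|(|E| - 2)| ^ 2 + η ^ 2) * ((|E| + 2) ^ 2 + η ^ 2) := by
    have h : (X ^ 2 + Y ^ 2) ^ 2 = (X ^ 2 - Y ^ 2) ^ 2 + 4 * (X * Y) ^ 2 := by ring
    rw [h, hre, him, sq_abs, ← sq_abs E, mul_pow, ← sq_abs E]; ring
  have hκ := abs_nonneg (|E| - 2)
  have hE0 := abs_nonneg E
  generalize |(|E| - 2)| = κ at *
  generalize |E| = e at *
  have hlo : 4 ≤ (e + 2) ^ 2 + η ^ 2 := by nlinarith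
  have hhi : (e + 2) ^ 2 + η ^ 2 ≤ 36 := by nlinarith
  constructor
  · refine le_of_sq_le_sq ?_ (by positivity)
    rw [hD]
    nlinarith [mul_le_mul_of_nonneg_left hlo (by positivity : 0 ≤ κ ^ 2 + η ^ 2),
      sq_nonneg (κ - η)]
  · refine le_of_sq_le_sq ?_ (by positivity)
    rw [hD]
    nlinarith [mul_le_mul_of_nonneg_left hhi (by positivity : 0 ≤ κ ^ 2 + η ^ 2),
      mul_nonneg hκ hη.le]

/-- On the domain `z = E + iη`, `|E| < 3`, `0 < η ≤ 3`, with `κ = ||E| - 2|`: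
if `|E| ≤ 2` then `Im m_sc(z) ∼ √(κ+η)`, and if `|E| ≥ 2` then
`Im m_sc(z) ∼ η/√(κ+η)`, uniformly (`m_sc(z)` characterized by
`m² + zm + 1 = 0`, `Im m > 0`). -/
theorem msc_im_bounds :
    ∃ c C : ℝ, 0 < c ∧ 0 < C ∧
      ∀ (E η : ℝ) (m : ℂ), |E| < 3 → 0 < η → η ≤ 3 →
        m ^ 2 + ((E : ℂ) + (η : ℂ) * Complex.I) * m + 1 = 0 → 0 < m.im →
        ((|E| ≤ 2 →
            c * Real.sqrt (|(|E| - 2)| + η) ≤ m.im ∧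
            m.im ≤ C * Real.sqrt (|(|E| - 2)| + η)) ∧
         (2 ≤ |E| →
            c * (η / Real.sqrt (|(|E| - 2)| + η)) ≤ m.im ∧
            m.im ≤ C * (η / Real.sqrt (|(|E| - 2)| + η)))) := by
  refine ⟨1 / 100, 10, by norm_num, by norm_num, ?_⟩
  rintro E η ⟨a, b⟩ hE hη hη3 hm hb
  have hre := congrArg Complex.re hm
  have him := congrArg Complex.im hm
  simp [pow_two] at hre him
  simp only at hb ⊢
  have hYb := im_two_mul_add_le (a := a) (b := b) hE.le hη hη3 hb
    (by linear_combination hre) (by linear_combination him)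
  obtain ⟨X, hX⟩ : ∃ X, X = 2 * a + E := ⟨_, rfl⟩
  obtain ⟨Y, hY⟩ : ∃ Y, Y = 2 * b + η := ⟨_, rfl⟩
  have hXY : X ^ 2 - Y ^ 2 = E ^ 2 - η ^ 2 - 4 := by
    rw [hX, hY]; linear_combination 4 * hre
  have hXmY : X * Y = E * η := by rw [hX, hY]; linear_combination 2 * him
  obtain ⟨hlo, hhi⟩ := normSq_bounds_of_sq_eq hE.le hη hη3 hXY hXmY
  have hY0 : 0 < Y := by rw [hY]; positivity
  have hp : 0 < |(|E| - 2)| + η := by positivity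
  obtain ⟨q, hq⟩ : ∃ q, q = Real.sqrt (|(|E| - 2)| + η) := ⟨_, rfl⟩
  have hq0 : 0 < q := hq ▸ Real.sqrt_pos.2 hp
  have hqq : q ^ 2 = |(|E| - 2)| + η := hq ▸ Real.sq_sqrt hp.le
  rw [← hq]
  rw [← hqq] at hlo hhi
  have hXA : |X| * Y = |E| * η := by
    rw [← abs_of_pos hY0, ← abs_mul, hXmY, abs_mul, abs_of_pos hη]
  rw [← sq_abs E, ← sq_abs X] at hXY
  rw [← sq_abs X] at hlo hhi
  have hX0 := abs_nonneg X
  have hE0 := abs_nonneg E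
  generalize |X| = x at *
  generalize |E| = e at *
  refine ⟨fun he => ?_, fun he => ?_⟩
  · have h1 : q ≤ 2 * Y := le_of_sq_le_sq (by nlinarith) (by positivity)
    have h2 : Y ≤ 3 * q := le_of_sq_le_sq (by nlinarith) (by positivity)
    constructor <;> linarith
  · rw [abs_of_nonneg (by linarith)] at hqq
    have h1 : x ≤ 3 * q := le_of_sq_le_sq (by nlinarith) (by positivity)
    have h2 : q ≤ 3 * x := by
      refine le_of_sq_le_sq ?_ (by positivity)
      rcases le_total (Y ^ 2) (x ^ 2) with h | h
      · linarith [mul_pow 3 x 2]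
      · have hηη : η ^ 2 ≤ 3 * η := by rw [sq]; gcongr
        have he2 := sq_nonneg (e - 2)
        have h3 : 4 * (e - 2) ≤ 3 * η := by linarith
        have h4 : 2 * η ≤ x * Y := by rw [hXA]; gcongr
        have h5 : 8 * q ^ 2 ≤ 7 * (x * Y) := by linarith
        have h6 : (8 * q ^ 2) ^ 2 ≤ (7 * (x * Y)) ^ 2 := by gcongr
        have h7 : x ^ 2 * Y ^ 2 ≤ x ^ 2 * (6 * q ^ 2) := by
          gcongr
          linarith [sq_nonneg x]
        have h8 : 0 ≤ x ^ 2 * q ^ 2 := by positivity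
        refine le_of_mul_le_mul_right ?_ (pow_pos hq0 2)
        linarith
    have h8 : 2 * η ≤ 3 * q * Y := by
      calc 2 * η ≤ e * η := by gcongr
        _ = x * Y := hXA.symm
        _ ≤ _ := by gcongr
    have h9 : q * Y ≤ 9 * η := by
      calc q * Y ≤ 3 * x * Y := by gcongr
        _ = 3 * (e * η) := by rw [← hXA]; ring
        _ ≤ 3 * (3 * η) := by gcongr
        _ = 9 * η := by ring
    have h10 : Y * q ≤ 50 * b * q := by
      rw [hY]
      gcongr
    have h11 : 2 * b * q ≤ Y * q := by
      gcongr
      linarith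
    constructor
    · rw [← mul_div_assoc, div_le_iff₀ hq0]
      linarith
    · rw [← mul_div_assoc, le_div_iff₀ hq0]
      linarith
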